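/- arXiv:2302.13808 — 4 statements merged into one kernel-verified Lean document; each statement's English description precedes it below -/
import Mathlib

section
/- Let g₁ and g₂ be finite-dimensional complex Lie algebras and let V be a finite-dimensional irreducible Lie module over the product Lie algebra g₁ × g₂ (with componentwise bracket). Then there exist a finite-dimensional irreducible g₁-module V₁ and a finite-dimensional irreducible g₂-module V₂ such that V is isomorphic, as a module over g₁ × g₂, to the external tensor product V₁ ⊠ V₂, i.e. the space V₁ ⊗ V₂ with action (x₁, x₂)·(v₁ ⊗ v₂) = (x₁·v₁) ⊗ v₂ + v₁ ⊗ (x₂·v₂). -/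
open TensorProduct

section ProdLie

variable (L₁ L₂ : Type*) [LieRing L₁] [LieRing L₂]

/-- The componentwise bracket on the product of two Lie rings. -/
instance Prod.instBracket : Bracket (L₁ × L₂) (L₁ × L₂) :=
  ⟨fun x y => (⁅x.1, y.1⁆, ⁅x.2, y.2⁆)⟩

@[simp] theorem Prod.bracket_def (x y : L₁ × L₂) :
    ⁅x, y⁆ = (⁅x.1, y.1⁆, ⁅x.2, y.2⁆) := rfl

/-- The product of two Lie rings, with componentwise bracket. -/
instance Prod.instLieRing : LieRing (L₁ × L₂) where
  add_lie x y z := by simp [Prod.ext_iff, add_lie]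
  lie_add x y z := by simp [Prod.ext_iff, lie_add]
  lie_self x := by simp [Prod.ext_iff]
  leibniz_lie x y z := by simp [Prod.ext_iff]

/-- The product of two Lie algebras over `ℂ`. -/
instance Prod.instLieAlgebra [LieAlgebra ℂ L₁] [LieAlgebra ℂ L₂] :
    LieAlgebra ℂ (L₁ × L₂) where
  lie_smul t x y := by simp [Prod.ext_iff]

end ProdLie

/-- A bundled Lie module over a Lie algebra `L` over `ℂ`. -/
structure BundledLieModule (L : Type*) [LieRing L] [LieAlgebra ℂ L] where
  carrier : Type*
  [addCommGroup : AddCommGroup carrier]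
  [module : Module ℂ carrier]
  [lieRingModule : LieRingModule L carrier]
  [lieModule : LieModule ℂ L carrier]

attribute [instance] BundledLieModule.addCommGroup BundledLieModule.module
  BundledLieModule.lieRingModule BundledLieModule.lieModule

section Intertwiner

variable {k ι κ V W : Type*} [Field k] [AddCommGroup V] [Module k V] [AddCommGroup W] [Module k W]

/-- A family of endomorphisms with no common invariant subspace other than `⊥` and `⊤`. -/
def IsIrreducibleFamily (ρ : ι → Module.End k W) : Prop :=
  ∀ S : Submodule k W, (∀ i, ∀ w ∈ S, ρ i w ∈ S) → S = ⊥ ∨ S = ⊤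

/-- The space of linear maps intertwining two families of endomorphisms. -/
def intertwiners (ρ : ι → Module.End k W) (σ : ι → Module.End k V) : Submodule k (W →ₗ[k] V) where
  carrier := {f | ∀ i w, f (ρ i w) = σ i (f w)}
  add_mem' hf hg i w := by simp [hf i w, hg i w]
  zero_mem' i w := by simp
  smul_mem' c f hf i w := by simp [hf i w]

/-- The evaluation map from `W` tensored with a space of linear maps `W → V`. -/
noncomputable def tensorEval (H : Submodule k (W →ₗ[k] V)) : W ⊗[k] H →ₗ[k] V :=
  TensorProduct.lift H.subtype.flip

@[simp] theorem tensorEval_tmul (H : Submodule k (W →ₗ[k] V)) (w : W) (f : H) :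
    tensorEval H (w ⊗ₜ f) = f.1 w := rfl

theorem IsIrreducibleFamily.exists_eq_smul_of_commute [IsAlgClosed k] [FiniteDimensional k W]
    {ρ : ι → Module.End k W} (hρ : IsIrreducibleFamily ρ) (φ : Module.End k W)
    (hφ : ∀ i w, φ (ρ i w) = ρ i (φ w)) : ∃ c : k, ∀ w, φ w = c • w := by
  rcases subsingleton_or_nontrivial W with _ | _
  · exact ⟨0, fun w => Subsingleton.elim _ _⟩
  obtain ⟨c, hc⟩ := Module.End.exists_eigenvalue φ
  refine ⟨c, fun w => ?_⟩
  have htop := (hρ (φ.eigenspace c) fun i w hw => by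
    rw [Module.End.mem_eigenspace_iff] at hw ⊢
    rw [hφ, hw, map_smul]).resolve_left hc
  exact Module.End.mem_eigenspace_iff.mp (htop ▸ Submodule.mem_top)

theorem IsIrreducibleFamily.eq_zero_of_sum_apply_eq_zero [IsAlgClosed k] [FiniteDimensional k W]
    {ρ : ι → Module.End k W} (hρ : IsIrreducibleFamily ρ) {σ : ι → Module.End k V} {n : ℕ}
    (f : Fin n → W →ₗ[k] V) (hf : ∀ j, f j ∈ intertwiners ρ σ) (hli : LinearIndependent k f)
    (w : Fin n → W) (hw : ∑ j, f j (w j) = 0) : w = 0 := by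
  induction n with
  | zero => exact Subsingleton.elim _ _
  | succ n ih =>
    obtain ⟨hli', h0⟩ := linearIndependent_finSucc.mp hli
    replace ih := ih (Fin.tail f) (fun j => hf j.succ) hli'
    let F : (Fin n → W) →ₗ[k] V := LinearMap.lsum k (fun _ => W) k (Fin.tail f)
    have hF (v : Fin n → W) : F v = ∑ j, f j.succ (v j) := by simp [F, Fin.tail]
    have hker : F.ker = ⊥ := by
      rw [LinearMap.ker_eq_bot']
      intro v hv
      exact ih v ((hF v).symm.trans hv)
    have hFρ (i) (v : Fin n → W) : F (fun j => ρ i (v j)) = σ i (F v) := by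
      simp [hF, hf _ i _]
    have hsum : f 0 (w 0) + F (Fin.tail w) = 0 := by
      rw [hF, ← hw, Fin.sum_univ_succ]; rfl
    rcases hρ (F.range.comap (f 0)) (by
      rintro i u ⟨v, hv⟩
      exact ⟨fun j => ρ i (v j), by rw [hFρ, hv, hf 0 i u]⟩) with hbot | htop
    · have hw0 : w 0 = 0 := by
        rw [← Submodule.mem_bot k, ← hbot]
        exact ⟨-Fin.tail w, by rw [map_neg, neg_eq_iff_add_eq_zero, add_comm, hsum]⟩
      have hwt : Fin.tail w = 0 := by
        refine LinearMap.ker_eq_bot'.mp hker _ ?_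
        simpa [hw0] using hsum
      funext j
      refine Fin.cases hw0 (fun j => congrFun hwt j) j
    · exfalso
      obtain ⟨G, hG⟩ := F.exists_leftInverse_of_injective hker
      have hFG (u : W) : F (G (f 0 u)) = f 0 u := by
        obtain ⟨v, hv⟩ : u ∈ F.range.comap (f 0) := htop ▸ Submodule.mem_top
        rw [← hv, ← LinearMap.comp_apply G F, hG, LinearMap.id_apply]
      have hcomm (i) (u : W) : G (f 0 (ρ i u)) = fun j => ρ i (G (f 0 u) j) := by
        apply LinearMap.ker_eq_bot.mp hker
        rw [hFG, hFρ, hFG, hf 0 i u]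
      choose c hc using fun j => hρ.exists_eq_smul_of_commute
        (LinearMap.proj j ∘ₗ G ∘ₗ f 0) (fun i u => by simp [hcomm])
      refine h0 ?_
      have hf0 : f 0 = ∑ j, c j • Fin.tail f j := by
        ext u
        rw [← hFG u, hF]
        simp only [LinearMap.comp_apply, LinearMap.proj_apply] at hc
        simp [hc, Fin.tail]
      rw [hf0]
      exact Submodule.sum_mem _ fun j _ =>
        Submodule.smul_mem _ _ (Submodule.subset_span (Set.mem_range_self j))

theorem IsIrreducibleFamily.tensorEval_injective [IsAlgClosed k] [FiniteDimensional k W]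
    [FiniteDimensional k V] {ρ : ι → Module.End k W} (hρ : IsIrreducibleFamily ρ)
    (σ : ι → Module.End k V) : Function.Injective (tensorEval (intertwiners ρ σ)) := by
  rw [injective_iff_map_eq_zero]
  intro t ht
  have B := Module.finBasis k (intertwiners ρ σ)
  obtain ⟨b, rfl⟩ := TensorProduct.eq_repr_basis_right B t
  have hli : LinearIndependent k fun j => (intertwiners ρ σ).subtype (B j) :=
    B.linearIndependent.map' (intertwiners ρ σ).subtype (Submodule.ker_subtype _)
  have hb : (b : _ → W) = 0 := by
    refine hρ.eq_zero_of_sum_apply_eq_zero _ (fun j => (B j).2) hli b ?_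
    simpa [Finsupp.sum_fintype] using ht
  rw [DFunLike.coe_injective (hb.trans Finsupp.coe_zero.symm), Finsupp.sum_zero_index]

theorem exists_minimal_invariant_submodule [FiniteDimensional k V] [Nontrivial V]
    (σ : ι → Module.End k V) : ∃ (S : Submodule k V) (hS : ∀ i, ∀ v ∈ S, σ i v ∈ S),
      Nontrivial S ∧ IsIrreducibleFamily fun i => (σ i).restrict (hS i) := by
  obtain ⟨S, ⟨hS, hne⟩, hmin⟩ := exists_minimal_of_wellFoundedLT
    (fun S : Submodule k V => (∀ i, ∀ v ∈ S, σ i v ∈ S) ∧ S ≠ ⊥)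
    ⟨⊤, fun _ _ _ => Submodule.mem_top, top_ne_bot⟩
  refine ⟨S, hS, Submodule.nontrivial_iff_ne_bot.mpr hne, fun T hT => or_iff_not_imp_left.mpr
    fun hT0 => ?_⟩
  have hle := hmin (y := T.map S.subtype) ⟨?_, ?_⟩ (Submodule.map_subtype_le S T)
  · rw [eq_top_iff]
    rintro ⟨v, hv⟩ -
    obtain ⟨t, ht, rfl⟩ := hle hv
    exact ht
  · rintro i _ ⟨t, ht, rfl⟩
    exact ⟨_, hT i t ht, rfl⟩
  · rwa [Ne, (Submodule.map_injective_of_injective S.injective_subtype).eq_iff' (Submodule.map_bot _)]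

/-- Postcomposition with an endomorphism commuting with `σ`. -/
def intertwinersPostcomp {ρ : ι → Module.End k W} {σ : ι → Module.End k V} (τ : Module.End k V)
    (hτ : ∀ i v, τ (σ i v) = σ i (τ v)) : Module.End k (intertwiners ρ σ) :=
  (LinearMap.compRight k τ).restrict fun f hf i w => by simp [hf i w, hτ]

theorem range_tensorEval_lTensor_eq_bot_or_eq_top {ρ : ι → Module.End k W}
    {σ : ι → Module.End k V} {τ : κ → Module.End k V} (hτ : ∀ j i v, τ j (σ i v) = σ i (τ j v))
    (hV : IsIrreducibleFamily (Sum.elim σ τ)) (S : Submodule k (intertwiners ρ σ))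
    (hS : ∀ j, ∀ f ∈ S, intertwinersPostcomp (τ j) (hτ j) f ∈ S) :
    (tensorEval (intertwiners ρ σ) ∘ₗ S.subtype.lTensor W).range = ⊥ ∨
      (tensorEval (intertwiners ρ σ) ∘ₗ S.subtype.lTensor W).range = ⊤ := by
  refine hV _ ?_
  rintro i _ ⟨t, rfl⟩
  induction t with
  | zero => simp
  | add x y hx hy => simpa using Submodule.add_mem _ hx hy
  | tmul w f =>
    rcases i with i | j
    · exact ⟨ρ i w ⊗ₜ f, f.1.2 i w⟩
    · exact ⟨w ⊗ₜ ⟨_, hS j f f.2⟩, rfl⟩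

theorem tensorEval_surjective {ρ : ι → Module.End k W}
    {σ : ι → Module.End k V} {τ : κ → Module.End k V} (hτ : ∀ j i v, τ j (σ i v) = σ i (τ j v))
    (hV : IsIrreducibleFamily (Sum.elim σ τ)) {f : W →ₗ[k] V} (hf : f ∈ intertwiners ρ σ)
    (hf0 : f ≠ 0) : Function.Surjective (tensorEval (intertwiners ρ σ)) := by
  have h := (range_tensorEval_lTensor_eq_bot_or_eq_top hτ hV (ρ := ρ) ⊤
    fun _ _ _ => Submodule.mem_top).resolve_left fun hbot => hf0 <| by
      ext w
      exact LinearMap.congr_fun (LinearMap.range_eq_bot.mp hbot)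
        (w ⊗ₜ (⟨⟨f, hf⟩, Submodule.mem_top⟩ : (⊤ : Submodule k (intertwiners ρ σ))))
  rw [LinearMap.range_eq_top, LinearMap.coe_comp] at h
  exact h.of_comp

theorem IsIrreducibleFamily.intertwinersPostcomp [IsAlgClosed k] [FiniteDimensional k W]
    [FiniteDimensional k V] [Nontrivial W] {ρ : ι → Module.End k W} (hρ : IsIrreducibleFamily ρ)
    {σ : ι → Module.End k V} {τ : κ → Module.End k V} (hτ : ∀ j i v, τ j (σ i v) = σ i (τ j v))
    (hV : IsIrreducibleFamily (Sum.elim σ τ)) :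
    IsIrreducibleFamily fun j =>
      (_root_.intertwinersPostcomp (τ j) (hτ j) : Module.End k (intertwiners ρ σ)) := by
  intro S hS
  refine (range_tensorEval_lTensor_eq_bot_or_eq_top hτ hV S hS).imp (fun h => ?_) fun h => ?_
  · rw [Submodule.eq_bot_iff]
    intro f hf
    ext w
    exact LinearMap.congr_fun (LinearMap.range_eq_bot.mp h) (w ⊗ₜ (⟨f, hf⟩ : S))
  · have h₁ := LinearMap.finrank_le_finrank_of_injective (hρ.tensorEval_injective σ)
    have h₂ := LinearMap.finrank_range_le
      (tensorEval (intertwiners ρ σ) ∘ₗ S.subtype.lTensor W)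
    have _ : Module.Free k S := Module.Free.of_divisionRing k S
    rw [h, finrank_top, Module.finrank_tensorProduct] at h₂
    rw [Module.finrank_tensorProduct] at h₁
    exact Submodule.eq_top_of_finrank_eq <| (Submodule.finrank_le S).antisymm <|
      Nat.le_of_mul_le_mul_left (h₁.trans h₂) Module.finrank_pos

end Intertwiner

universe w in
/-- An irreducible finite-dimensional representation is realised by a module in any universe. -/
theorem exists_bundledLieModule_equiv {L W : Type*} [LieRing L] [LieAlgebra ℂ L] [AddCommGroup W]
    [Module ℂ W] [FiniteDimensional ℂ W] [Nontrivial W] (ρ : L →ₗ[ℂ] Module.End ℂ W)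
    (hlie : ∀ x y w, ρ ⁅x, y⁆ w = ρ x (ρ y w) - ρ y (ρ x w)) (hρ : IsIrreducibleFamily ρ) :
    ∃ M : BundledLieModule.{_, w} L, FiniteDimensional ℂ M.carrier ∧
      LieModule.IsIrreducible ℂ L M.carrier ∧
      ∃ e : W ≃ₗ[ℂ] M.carrier, ∀ x w, e (ρ x w) = ⁅x, e w⁆ := by
  let e : W ≃ₗ[ℂ] ULift.{w} (Fin (Module.finrank ℂ W) → ℂ) :=
    (Module.finBasis ℂ W).equivFun ≪≫ₗ ULift.moduleEquiv.symm
  let _ : LieRingModule L (ULift.{w} (Fin (Module.finrank ℂ W) → ℂ)) :=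
    { bracket := fun x v => e (ρ x (e.symm v))
      add_lie := fun x y v => by simp
      lie_add := fun x v w => by simp
      leibniz_lie := fun x y v => by
        change e _ = e (ρ ⁅x, y⁆ _) + e _
        simp [hlie, e.symm_apply_apply] }
  have he (x : L) (w : W) : e (ρ x w) = ⁅x, e w⁆ := by
    change _ = e (ρ x (e.symm (e w)))
    rw [e.symm_apply_apply]
  have _ : LieModule ℂ L (ULift.{w} (Fin (Module.finrank ℂ W) → ℂ)) :=
    { smul_lie := fun c x v => by
        obtain ⟨w, rfl⟩ := e.surjective v
        simp [← he]
      lie_smul := fun c x v => by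
        obtain ⟨w, rfl⟩ := e.surjective v
        rw [← map_smul, ← he, ← he, map_smul, map_smul] }
  have _ : Nontrivial (ULift.{w} (Fin (Module.finrank ℂ W) → ℂ)) := e.symm.toEquiv.nontrivial
  refine ⟨⟨ULift.{w} (Fin (Module.finrank ℂ W) → ℂ)⟩, e.finiteDimensional, ?_, e, he⟩
  refine LieModule.IsIrreducible.mk fun N hN => ?_
  have h := hρ (N.toSubmodule.comap e.toLinearMap) fun x w hw => by
    change e (ρ x w) ∈ N
    rw [he]
    exact N.lie_mem hw
  rcases h with h | h
  · refine absurd ?_ hN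
    rw [LieSubmodule.eq_bot_iff]
    intro v hv
    have : e.symm v ∈ N.toSubmodule.comap e.toLinearMap := by simpa using hv
    rw [h, Submodule.mem_bot] at this
    simpa using this
  · rw [← LieSubmodule.toSubmodule_eq_top, eq_top_iff]
    intro v _
    have : e.symm v ∈ N.toSubmodule.comap e.toLinearMap := h ▸ Submodule.mem_top
    simpa using this

/-- Every finite-dimensional irreducible Lie module `V` over the product `g₁ × g₂`
of two finite-dimensional complex Lie algebras is isomorphic to an external tensor
product `V₁ ⊠ V₂` of finite-dimensional irreducible modules over `g₁` and `g₂`,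
where `(x₁, x₂)` acts on `V₁ ⊗ V₂` by `x₁ ⊗ 1 + 1 ⊗ x₂`. -/
theorem irreducible_module_of_product_lie_algebra_is_external_tensor
    (g₁ g₂ : Type*) [LieRing g₁] [LieAlgebra ℂ g₁] [LieRing g₂] [LieAlgebra ℂ g₂]
    [FiniteDimensional ℂ g₁] [FiniteDimensional ℂ g₂]
    (V : Type*) [AddCommGroup V] [Module ℂ V]
    [LieRingModule (g₁ × g₂) V] [LieModule ℂ (g₁ × g₂) V]
    [FiniteDimensional ℂ V] [LieModule.IsIrreducible ℂ (g₁ × g₂) V] :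
    ∃ (M₁ : BundledLieModule g₁) (M₂ : BundledLieModule g₂),
      FiniteDimensional ℂ M₁.carrier ∧ FiniteDimensional ℂ M₂.carrier ∧
      LieModule.IsIrreducible ℂ g₁ M₁.carrier ∧
      LieModule.IsIrreducible ℂ g₂ M₂.carrier ∧
      ∃ e : V ≃ₗ[ℂ] M₁.carrier ⊗[ℂ] M₂.carrier,
        ∀ (x₁ : g₁) (x₂ : g₂) (v : V),
          e ⁅(⟨x₁, x₂⟩ : g₁ × g₂), v⁆ =
            TensorProduct.map (LieModule.toEnd ℂ g₁ M₁.carrier x₁) LinearMap.id (e v) +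
            TensorProduct.map LinearMap.id (LieModule.toEnd ℂ g₂ M₂.carrier x₂) (e v) := by
  let a : g₁ → Module.End ℂ V := fun x => LieModule.toEnd ℂ (g₁ × g₂) V (x, 0)
  let b : g₂ → Module.End ℂ V := fun y => LieModule.toEnd ℂ (g₁ × g₂) V (0, y)
  have ha (x v) : a x v = ⁅((x, 0) : g₁ × g₂), v⁆ := rfl
  have hb (y v) : b y v = ⁅((0, y) : g₁ × g₂), v⁆ := rfl
  have hab (x y v) : ⁅((x, y) : g₁ × g₂), v⁆ = a x v + b y v := by
    rw [ha, hb, ← add_lie, Prod.mk_add_mk, add_zero, zero_add]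
  have hcomm (y x v) : b y (a x v) = a x (b y v) := by
    simp only [ha, hb]
    rw [leibniz_lie, Prod.bracket_def, lie_zero, zero_lie, Prod.mk_zero_zero, zero_lie, zero_add]
  have hV : IsIrreducibleFamily (Sum.elim a b) := by
    intro S hS
    have hlie (x : g₁ × g₂) (m : V) (hm : m ∈ S) : ⁅x, m⁆ ∈ S := by
      rw [← Prod.mk.eta (p := x), hab]
      exact S.add_mem (hS (Sum.inl x.1) m hm) (hS (Sum.inr x.2) m hm)
    let N : LieSubmodule ℂ (g₁ × g₂) V := { S with lie_mem := hlie _ _ }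
    refine (eq_bot_or_eq_top N).imp (fun h => ?_) fun h => ?_
    · rw [← LieSubmodule.toSubmodule_eq_bot] at h
      exact h
    · rw [← LieSubmodule.toSubmodule_eq_top] at h
      exact h
  have _ : Nontrivial V := (LieSubmodule.nontrivial_iff ℂ (g₁ × g₂) V).mp inferInstance
  obtain ⟨W, hW, _, hirr⟩ := exists_minimal_invariant_submodule a
  let ρ₁ : g₁ →ₗ[ℂ] Module.End ℂ W :=
    { toFun := fun x => (a x).restrict (hW x)
      map_add' := fun x y => by
        ext v
        change ⁅((x + y, 0) : g₁ × g₂), v.1⁆ = ⁅((x, 0) : g₁ × g₂), v.1⁆ + ⁅((y, 0) : g₁ × g₂), v.1⁆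
        rw [← add_lie, Prod.mk_add_mk, add_zero]
      map_smul' := fun c x => by
        ext v
        change ⁅((c • x, 0) : g₁ × g₂), v.1⁆ = c • ⁅((x, 0) : g₁ × g₂), v.1⁆
        rw [← smul_lie, Prod.smul_mk, smul_zero] }
  have hlie₁ (x y v) : ρ₁ ⁅x, y⁆ v = ρ₁ x (ρ₁ y v) - ρ₁ y (ρ₁ x v) := by
    ext
    change ⁅((⁅x, y⁆, 0) : g₁ × g₂), v.1⁆ = ⁅((x, 0) : g₁ × g₂), ⁅((y, 0) : g₁ × g₂), v.1⁆⁆ -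
      ⁅((y, 0) : g₁ × g₂), ⁅((x, 0) : g₁ × g₂), v.1⁆⁆
    rw [← lie_lie, Prod.bracket_def, lie_self]
  let ρ₂ : g₂ →ₗ[ℂ] Module.End ℂ (intertwiners ρ₁ a) :=
    { toFun := fun y => intertwinersPostcomp (b y) (hcomm y)
      map_add' := fun x y => by
        ext f v
        change ⁅((0, x + y) : g₁ × g₂), f.1 v⁆ =
          ⁅((0, x) : g₁ × g₂), f.1 v⁆ + ⁅((0, y) : g₁ × g₂), f.1 v⁆
        rw [← add_lie, Prod.mk_add_mk, add_zero]
      map_smul' := fun c x => by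
        ext f v
        change ⁅((0, c • x) : g₁ × g₂), f.1 v⁆ = c • ⁅((0, x) : g₁ × g₂), f.1 v⁆
        rw [← smul_lie, Prod.smul_mk, smul_zero] }
  have hlie₂ (x y f) : ρ₂ ⁅x, y⁆ f = ρ₂ x (ρ₂ y f) - ρ₂ y (ρ₂ x f) := by
    ext v
    change ⁅((0, ⁅x, y⁆) : g₁ × g₂), f.1 v⁆ =
      ⁅((0, x) : g₁ × g₂), ⁅((0, y) : g₁ × g₂), f.1 v⁆⁆ -
      ⁅((0, y) : g₁ × g₂), ⁅((0, x) : g₁ × g₂), f.1 v⁆⁆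
    rw [← lie_lie, Prod.bracket_def, lie_self]
  have hρ₁ : IsIrreducibleFamily ρ₁ := hirr
  have hρ₂ : IsIrreducibleFamily ρ₂ := hρ₁.intertwinersPostcomp hcomm hV
  have hsub : W.subtype ∈ intertwiners ρ₁ a := fun _ _ => rfl
  have hsub0 : W.subtype ≠ 0 := fun h => by
    obtain ⟨v, hv⟩ := exists_ne (0 : W)
    exact hv (Subtype.ext (LinearMap.congr_fun h v))
  have _ : Nontrivial (intertwiners ρ₁ a) :=
    ⟨⟨W.subtype, hsub⟩, 0, fun h => hsub0 (congrArg Subtype.val h)⟩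
  obtain ⟨M₁, hfin₁, hirr₁, e₁, he₁⟩ := exists_bundledLieModule_equiv ρ₁ hlie₁ hρ₁
  obtain ⟨M₂, hfin₂, hirr₂, e₂, he₂⟩ := exists_bundledLieModule_equiv ρ₂ hlie₂ hρ₂
  let E := LinearEquiv.ofBijective (tensorEval (intertwiners ρ₁ a))
    ⟨hρ₁.tensorEval_injective a, tensorEval_surjective hcomm hV hsub hsub0⟩
  refine ⟨M₁, M₂, hfin₁, hfin₂, hirr₁, hirr₂, E.symm ≪≫ₗ TensorProduct.congr e₁ e₂, ?_⟩
  intro x₁ x₂ v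
  obtain ⟨t, rfl⟩ := E.surjective v
  induction t with
  | zero => simp
  | add s t hs ht =>
    simp only [map_add, lie_add, hs, ht]
    abel
  | tmul w f =>
    have h : ⁅((x₁, x₂) : g₁ × g₂), E (w ⊗ₜ f)⁆ = E (ρ₁ x₁ w ⊗ₜ f + w ⊗ₜ ρ₂ x₂ f) := by
      rw [hab, map_add]
      exact congrArg (· + b x₂ (f.1 w)) (f.2 x₁ w).symm
    rw [h]
    simp [he₁, he₂]
end

section
/- If A ∈ SL(2,ℂ) satisfies Aᴴ X A = X for every Hermitian 2×2 complex matrix X, then A = I or A = −I. (The kernel of the covering map SL(2,ℂ) → SO⁺(1,3) is {±I}.) -/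
open Matrix

/-- If `A ∈ SL(2,ℂ)` satisfies `Aᴴ X A = X` for every Hermitian `2×2` matrix `X`,
then `A = I` or `A = -I`. -/
theorem sl2_fixing_all_hermitian_eq_pm_one
    (A : Matrix (Fin 2) (Fin 2) ℂ) (hA : A.det = 1)
    (h : ∀ X : Matrix (Fin 2) (Fin 2) ℂ, X.IsHermitian → Aᴴ * X * A = X) :
    A = 1 ∨ A = -1 := by
  have h₁ := h !![1, 0; 0, 0] (by ext i j; fin_cases i <;> fin_cases j <;> simp)
  have h₂ := h !![0, 0; 0, 1] (by ext i j; fin_cases i <;> fin_cases j <;> simp)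
  have h₃ := h !![0, 1; 1, 0] (by ext i j; fin_cases i <;> fin_cases j <;> simp)
  have ha : star (A 0 0) * A 0 0 = 1 := by
    simpa [Matrix.mul_apply, Fin.sum_univ_two] using congrFun₂ h₁ 0 0
  have hb : A 0 1 = 0 := by
    simpa [Matrix.mul_apply, Fin.sum_univ_two] using congrFun₂ h₁ 1 1
  have hc : A 1 0 = 0 := by
    simpa [Matrix.mul_apply, Fin.sum_univ_two] using congrFun₂ h₂ 0 0
  have had : star (A 0 0) * A 1 1 = 1 := by
    simpa [Matrix.mul_apply, Fin.sum_univ_two, hb, hc] using congrFun₂ h₃ 0 1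
  have hd : A 1 1 = A 0 0 :=
    mul_left_cancel₀ (left_ne_zero_of_mul_eq_one ha) (had.trans ha.symm)
  have hsq : A 0 0 * A 0 0 = 1 := by
    simpa [Matrix.det_fin_two, hb, hd] using hA
  refine (mul_self_eq_one_iff.mp hsq).imp (fun h₀ => ?_) (fun h₀ => ?_) <;>
    ext i j <;> fin_cases i <;> fin_cases j <;> simp [h₀, hb, hc, hd]
end

section
/- For every A ∈ SL(2,ℂ) there exists a unique real 4×4 matrix λ(A) such that Aᴴ X(v) A = X(λ(A)·v) for all v ∈ ℝ⁴. Moreover: (a) λ(A) is a Lorentz matrix, i.e. λ(A)ᵀ η λ(A) = η; (b) λ(I) = I; and (c) λ(AB) = λ(B)·λ(A) for all A, B ∈ SL(2,ℂ). -/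
open Matrix Complex

/-- The Hermitian matrix `X(v)` associated with `v = (t,x,y,z) ∈ ℝ⁴`. -/
noncomputable def Xmat (v : Fin 4 → ℝ) : Matrix (Fin 2) (Fin 2) ℂ :=
  !![(v 0 : ℂ) + v 3, (v 1 : ℂ) + I * v 2;
     (v 1 : ℂ) - I * v 2, (v 0 : ℂ) - v 3]

/-- The Minkowski matrix `η = diag(1,−1,−1,−1)`. -/
noncomputable def etaMink : Matrix (Fin 4) (Fin 4) ℝ :=
  Matrix.diagonal ![1, -1, -1, -1]

/-- The coordinates `(t,x,y,z)` of a `2×2` complex matrix; on Hermitian matrices this inverts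
`Xmat`. -/
noncomputable def minkCoords : Matrix (Fin 2) (Fin 2) ℂ →ₗ[ℝ] (Fin 4 → ℝ) where
  toFun M := ![(M 0 0 + M 1 1).re / 2, (M 0 1 + M 1 0).re / 2,
    (M 0 1 - M 1 0).im / 2, (M 0 0 - M 1 1).re / 2]
  map_add' M N := by
    ext i
    fin_cases i <;> simp <;> ring
  map_smul' c M := by
    ext i
    fin_cases i <;> simp <;> ring

/-- `Xmat` as a real-linear map. -/
noncomputable def XmatLinear : (Fin 4 → ℝ) →ₗ[ℝ] Matrix (Fin 2) (Fin 2) ℂ where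
  toFun := Xmat
  map_add' v w := by
    ext i j
    fin_cases i <;> fin_cases j <;> simp [Xmat] <;> ring
  map_smul' c v := by
    ext i j
    fin_cases i <;> fin_cases j <;> simp [Xmat] <;> ring

theorem minkCoords_Xmat (v : Fin 4 → ℝ) : minkCoords (Xmat v) = v := by
  ext i
  fin_cases i <;> simp [minkCoords, Xmat]

theorem Xmat_injective : Function.Injective Xmat :=
  Function.LeftInverse.injective minkCoords_Xmat

theorem Xmat_isHermitian (v : Fin 4 → ℝ) : (Xmat v).IsHermitian := by
  ext i j
  fin_cases i <;> fin_cases j <;> simp [Xmat, sub_eq_add_neg]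

theorem Xmat_minkCoords {M : Matrix (Fin 2) (Fin 2) ℂ} (hM : M.IsHermitian) :
    Xmat (minkCoords M) = M := by
  have h00 := Complex.ext_iff.mp (hM.apply 0 0)
  have h11 := Complex.ext_iff.mp (hM.apply 1 1)
  have h01 := Complex.ext_iff.mp (hM.apply 0 1)
  simp only [RCLike.star_def, conj_re, conj_im] at h00 h11 h01
  ext i j
  fin_cases i <;> fin_cases j <;> apply Complex.ext <;>
    simp [Xmat, minkCoords] <;> linarith [h00.2, h11.2, h01.1, h01.2]

/-- The real `4×4` matrix of `v ↦ Aᴴ X(v) A` in Minkowski coordinates. -/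
noncomputable def lorentzOf (A : Matrix (Fin 2) (Fin 2) ℂ) : Matrix (Fin 4) (Fin 4) ℝ :=
  LinearMap.toMatrix'
    (minkCoords ∘ₗ LinearMap.mulRight ℝ A ∘ₗ LinearMap.mulLeft ℝ Aᴴ ∘ₗ XmatLinear)

theorem Xmat_lorentzOf_mulVec (A : Matrix (Fin 2) (Fin 2) ℂ) (v : Fin 4 → ℝ) :
    Xmat (lorentzOf A *ᵥ v) = Aᴴ * Xmat v * A := by
  rw [lorentzOf, LinearMap.toMatrix'_mulVec]
  exact Xmat_minkCoords (isHermitian_conjTranspose_mul_mul A (Xmat_isHermitian v))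

theorem eq_of_Xmat_mulVec_eq {M N : Matrix (Fin 4) (Fin 4) ℝ}
    (h : ∀ v, Xmat (M *ᵥ v) = Xmat (N *ᵥ v)) : M = N :=
  Matrix.ext_of_mulVec_single fun i => Xmat_injective (h (Pi.single i 1))

theorem det_Xmat (v : Fin 4 → ℝ) : (Xmat v).det = ((v ⬝ᵥ etaMink *ᵥ v : ℝ) : ℂ) := by
  simp only [Xmat, det_fin_two_of, etaMink, mulVec_diagonal, dotProduct, Fin.sum_univ_four]
  simp
  linear_combination (v 2 : ℂ) ^ 2 * I_sq

/-- A real symmetric matrix is determined by its quadratic form. -/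
theorem Matrix.IsSymm.eq_of_dotProduct_mulVec_eq {n : Type*} [Fintype n]
    {M N : Matrix n n ℝ} (hM : M.IsSymm) (hN : N.IsSymm)
    (h : ∀ v, v ⬝ᵥ M *ᵥ v = v ⬝ᵥ N *ᵥ v) : M = N := by
  classical
  ext i j
  have hi := h (Pi.single i 1)
  have hj := h (Pi.single j 1)
  have hij := h (Pi.single i 1 + Pi.single j 1)
  simp only [mulVec_add, dotProduct_add, add_dotProduct, mulVec_single_one,
    single_one_dotProduct, col_apply] at hi hj hij
  linarith [hM.apply i j, hN.apply i j]

theorem lorentzOf_transpose_mul_etaMink_mul {A : Matrix (Fin 2) (Fin 2) ℂ} (hA : A.det = 1) :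
    (lorentzOf A)ᵀ * etaMink * lorentzOf A = etaMink := by
  have heta : etaMink.IsSymm := isSymm_diagonal _
  refine Matrix.IsSymm.eq_of_dotProduct_mulVec_eq ?_ heta fun v => ?_
  · simp [Matrix.IsSymm, transpose_mul, heta.eq, Matrix.mul_assoc]
  · rw [← mulVec_mulVec, ← mulVec_mulVec, dotProduct_mulVec, vecMul_transpose]
    apply Complex.ofReal_injective
    rw [← det_Xmat, ← det_Xmat, Xmat_lorentzOf_mulVec]
    simp [det_conjTranspose, hA]

theorem lorentzOf_one : lorentzOf 1 = 1 :=
  eq_of_Xmat_mulVec_eq fun v => by simp [Xmat_lorentzOf_mulVec]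

theorem lorentzOf_mul (A B : Matrix (Fin 2) (Fin 2) ℂ) :
    lorentzOf (A * B) = lorentzOf B * lorentzOf A :=
  eq_of_Xmat_mulVec_eq fun v => by
    simp only [← mulVec_mulVec, Xmat_lorentzOf_mulVec, conjTranspose_mul, Matrix.mul_assoc]

/-- For every `A ∈ SL(2,ℂ)` there is a unique real `4×4` matrix `λ(A)` with
`Aᴴ X(v) A = X(λ(A)v)` for all `v`; moreover `λ(A)` is a Lorentz matrix,
`λ(I) = I`, and `λ(AB) = λ(B)λ(A)`. -/
theorem sl2C_to_lorentz :
    ∃ lam : Matrix.SpecialLinearGroup (Fin 2) ℂ → Matrix (Fin 4) (Fin 4) ℝ,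
      (∀ A : Matrix.SpecialLinearGroup (Fin 2) ℂ,
        (∀ v : Fin 4 → ℝ,
          (A : Matrix (Fin 2) (Fin 2) ℂ)ᴴ * Xmat v * (A : Matrix (Fin 2) (Fin 2) ℂ) =
            Xmat ((lam A).mulVec v)) ∧
        (∀ Λ' : Matrix (Fin 4) (Fin 4) ℝ,
          (∀ v : Fin 4 → ℝ,
            (A : Matrix (Fin 2) (Fin 2) ℂ)ᴴ * Xmat v * (A : Matrix (Fin 2) (Fin 2) ℂ) =
              Xmat (Λ'.mulVec v)) → Λ' = lam A) ∧
        (lam A)ᵀ * etaMink * lam A = etaMink) ∧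
      lam 1 = 1 ∧
      (∀ A B : Matrix.SpecialLinearGroup (Fin 2) ℂ, lam (A * B) = lam B * lam A) := by
  refine ⟨fun A => lorentzOf A, fun A => ⟨fun v => (Xmat_lorentzOf_mulVec _ v).symm,
    fun M hM => eq_of_Xmat_mulVec_eq fun v => ?_,
    lorentzOf_transpose_mul_etaMink_mul A.det_coe⟩, ?_, fun A B => ?_⟩
  · rw [← hM, Xmat_lorentzOf_mulVec]
  · simpa using lorentzOf_one
  · simpa using lorentzOf_mul (A : Matrix (Fin 2) (Fin 2) ℂ) B
end

section
/- (Lorentz invariance of the volume measure on the mass shell) Let m > 0 and for p ∈ ℝ³ set E(p) = √(m² + ‖p‖²). Let Λ be a real 4×4 matrix (rows and columns indexed 0,1,2,3) with Λᵀ η Λ = η and Λ₀₀ > 0 (orthochronous). Define Φ : ℝ³ → ℝ³ by Φ(p)ᵢ = Λᵢ₀·E(p) + ∑_{j=1}^{3} Λᵢⱼ·pⱼ for i = 1,2,3 (the spatial part of the image of (E(p), p) under Λ). Let μ be the measure on ℝ³ given by Lebesgue measure with density p ↦ 1/E(p). Then the pushforward of μ under Φ equals μ. (The measure d³p / p⁰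 on the mass shell is Lorentz invariant.) -/
open Matrix MeasureTheory

/-- The energy `E(p) = √(m² + ‖p‖²)` on the mass shell of mass `m`. -/
noncomputable def energy (m : ℝ) (p : Fin 3 → ℝ) : ℝ :=
  Real.sqrt (m ^ 2 + ∑ i, p i ^ 2)

theorem etaMink_mul_self : etaMink * etaMink = 1 := by
  rw [etaMink, diagonal_mul_diagonal, ← diagonal_one]
  congr 1
  ext i
  fin_cases i <;> simp

theorem dotProduct_etaMink_mulVec (u v : Fin 4 → ℝ) :
    u ⬝ᵥ etaMink *ᵥ v = u 0 * v 0 - ∑ i : Fin 3, u i.succ * v i.succ := by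
  simp only [etaMink, dotProduct, mulVec_diagonal, Fin.sum_univ_succ (n := 3)]
  simp [Fin.sum_univ_three]
  ring

/-- The Lorentz condition, in the form giving the inverse of `Λ`. -/
theorem lorentz_left_inv {Λ : Matrix (Fin 4) (Fin 4) ℝ} (hΛ : Λᵀ * etaMink * Λ = etaMink) :
    etaMink * Λᵀ * etaMink * Λ = 1 := by
  rw [mul_assoc etaMink, mul_assoc etaMink, hΛ, etaMink_mul_self]

theorem lorentz_right_inv {Λ : Matrix (Fin 4) (Fin 4) ℝ} (hΛ : Λᵀ * etaMink * Λ = etaMink) :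
    Λ * (etaMink * Λᵀ * etaMink) = 1 :=
  mul_eq_one_comm.mp (lorentz_left_inv hΛ)

theorem lorentz_transpose {Λ : Matrix (Fin 4) (Fin 4) ℝ} (hΛ : Λᵀ * etaMink * Λ = etaMink) :
    Λ * etaMink * Λᵀ = etaMink := by
  calc Λ * etaMink * Λᵀ
      = Λ * (etaMink * Λᵀ * etaMink) * etaMink := by
        simp only [mul_assoc, etaMink_mul_self, mul_one]
    _ = etaMink := by rw [lorentz_right_inv hΛ, one_mul]

theorem etaMink_transpose : etaMinkᵀ = etaMink := diagonal_transpose _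

theorem lorentz_inv {Λ : Matrix (Fin 4) (Fin 4) ℝ} (hΛ : Λᵀ * etaMink * Λ = etaMink) :
    (etaMink * Λᵀ * etaMink)ᵀ * etaMink * (etaMink * Λᵀ * etaMink) = etaMink := by
  simp only [transpose_mul, transpose_transpose, etaMink_transpose]
  calc etaMink * (Λ * etaMink) * etaMink * (etaMink * Λᵀ * etaMink)
      = etaMink * (Λ * etaMink * (etaMink * etaMink) * Λᵀ) * etaMink := by
        simp only [mul_assoc]
    _ = etaMink := by
        rw [etaMink_mul_self, mul_one, lorentz_transpose hΛ, etaMink_mul_self, one_mul]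

theorem lorentz_inv_zero_zero (Λ : Matrix (Fin 4) (Fin 4) ℝ) :
    (etaMink * Λᵀ * etaMink) 0 0 = Λ 0 0 := by
  simp [etaMink, mul_diagonal, diagonal_mul]

theorem abs_det_lorentz {Λ : Matrix (Fin 4) (Fin 4) ℝ} (hΛ : Λᵀ * etaMink * Λ = etaMink) :
    |Λ.det| = 1 := by
  have hη : etaMink.det ≠ 0 := by
    intro h
    simpa [h] using congrArg det etaMink_mul_self
  have h := congrArg det hΛ
  rw [det_mul, det_mul, det_transpose] at h
  have h2 : Λ.det ^ 2 = 1 := mul_left_cancel₀ hη (by linarith)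
  simpa using (sq_eq_sq_iff_abs_eq_abs Λ.det 1).mp (by simpa using h2)

theorem sq_energy (m : ℝ) (p : Fin 3 → ℝ) : energy m p ^ 2 = m ^ 2 + ∑ i, p i ^ 2 :=
  Real.sq_sqrt (by positivity)

theorem energy_pos {m : ℝ} (hm : 0 < m) (p : Fin 3 → ℝ) : 0 < energy m p :=
  Real.sqrt_pos.mpr (by positivity)

/-- The four-momentum `(E(p), p)` on the mass shell with spatial part `p`. -/
noncomputable def fourMomentum (m : ℝ) (p : Fin 3 → ℝ) : Fin 4 → ℝ :=
  Fin.cons (energy m p) p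

@[simp]
theorem fourMomentum_zero (m : ℝ) (p : Fin 3 → ℝ) : fourMomentum m p 0 = energy m p := rfl

@[simp]
theorem fourMomentum_succ (m : ℝ) (p : Fin 3 → ℝ) (i : Fin 3) :
    fourMomentum m p i.succ = p i := rfl

/-- The action of a matrix on the mass shell, in the coordinates given by the spatial part. -/
noncomputable def massShellMap (m : ℝ) (Λ : Matrix (Fin 4) (Fin 4) ℝ) (p : Fin 3 → ℝ) :
    Fin 3 → ℝ :=
  fun i => Λ i.succ 0 * energy m p + ∑ j : Fin 3, Λ i.succ j.succ * p j

theorem massShellMap_apply (m : ℝ) (Λ : Matrix (Fin 4) (Fin 4) ℝ) (p : Fin 3 → ℝ) (i : Fin 3) :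
    massShellMap m Λ p i = (Λ *ᵥ fourMomentum m p) i.succ := by
  simp [massShellMap, mulVec, dotProduct, Fin.sum_univ_succ (n := 3)]

theorem mulVec_fourMomentum_zero_pos {m : ℝ} (hm : 0 < m) {Λ : Matrix (Fin 4) (Fin 4) ℝ}
    (hΛ : Λᵀ * etaMink * Λ = etaMink) (hortho : 0 < Λ 0 0) (p : Fin 3 → ℝ) :
    0 < (Λ *ᵥ fourMomentum m p) 0 := by
  have hrow : Λ 0 0 * Λ 0 0 - ∑ i : Fin 3, Λ 0 i.succ * Λ 0 i.succ = 1 := by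
    have h := congrFun₂ (lorentz_transpose hΛ) 0 0
    rw [etaMink, Matrix.mul_apply] at h
    simp only [mul_diagonal, Fin.sum_univ_succ (n := 3)] at h
    simp [Fin.sum_univ_three] at h ⊢
    linarith
  have hcs := Finset.sum_mul_sq_le_sq_mul_sq Finset.univ (fun i : Fin 3 => Λ 0 i.succ) p
  have hE := sq_energy m p
  have hEpos := energy_pos hm p
  have hval : (Λ *ᵥ fourMomentum m p) 0
      = Λ 0 0 * energy m p + ∑ j : Fin 3, Λ 0 j.succ * p j := by
    simp [mulVec, dotProduct, Fin.sum_univ_succ (n := 3)]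
  rw [hval]
  have hA : ∑ i : Fin 3, Λ 0 i.succ ^ 2 = Λ 0 0 ^ 2 - 1 := by
    simp only [pow_two]; linarith
  have hB : ∑ i, p i ^ 2 = energy m p ^ 2 - m ^ 2 := by linarith
  have hA0 : 0 ≤ ∑ i : Fin 3, Λ 0 i.succ ^ 2 := by positivity
  have hlt : (∑ j : Fin 3, Λ 0 j.succ * p j) ^ 2 < (Λ 0 0 * energy m p) ^ 2 := by
    rw [hA] at hcs hA0
    rw [hB] at hcs
    nlinarith [mul_nonneg hA0 (sq_nonneg m), pow_pos hEpos 2]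
  linarith [neg_lt_of_abs_lt (abs_lt_of_sq_lt_sq hlt (by positivity))]

theorem mulVec_fourMomentum {m : ℝ} (hm : 0 < m) {Λ : Matrix (Fin 4) (Fin 4) ℝ}
    (hΛ : Λᵀ * etaMink * Λ = etaMink) (hortho : 0 < Λ 0 0) (p : Fin 3 → ℝ) :
    Λ *ᵥ fourMomentum m p = fourMomentum m (massShellMap m Λ p) := by
  set q := fourMomentum m p with hq
  have hinv : (Λ *ᵥ q) ⬝ᵥ etaMink *ᵥ (Λ *ᵥ q) = q ⬝ᵥ etaMink *ᵥ q := by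
    conv_rhs =>
      rw [← hΛ, ← mulVec_mulVec, ← mulVec_mulVec, dotProduct_mulVec, vecMul_transpose]
  rw [dotProduct_etaMink_mulVec, dotProduct_etaMink_mulVec] at hinv
  funext i
  refine Fin.cases ?_ (fun j => ?_) i
  · have hE := sq_energy m p
    rw [fourMomentum_zero, energy, eq_comm,
      ← Real.sqrt_sq (mulVec_fourMomentum_zero_pos hm hΛ hortho p).le]
    congr 1
    simp only [massShellMap_apply, ← hq]
    simp only [hq, fourMomentum_zero, fourMomentum_succ, pow_two] at hinv hE ⊢
    linarith
  · rw [fourMomentum_succ, massShellMap_apply]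

theorem massShellMap_massShellMap {m : ℝ} (hm : 0 < m) {Λ Λ' : Matrix (Fin 4) (Fin 4) ℝ}
    (hΛ : Λᵀ * etaMink * Λ = etaMink) (hortho : 0 < Λ 0 0) (h : Λ' * Λ = 1) (p : Fin 3 → ℝ) :
    massShellMap m Λ' (massShellMap m Λ p) = p := by
  ext i
  rw [massShellMap_apply, ← mulVec_fourMomentum hm hΛ hortho, mulVec_mulVec, h, one_mulVec,
    fourMomentum_succ]

theorem massShellMap_bijective {m : ℝ} (hm : 0 < m) {Λ : Matrix (Fin 4) (Fin 4) ℝ}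
    (hΛ : Λᵀ * etaMink * Λ = etaMink) (hortho : 0 < Λ 0 0) :
    Function.Bijective (massShellMap m Λ) :=
  Function.bijective_iff_has_inverse.mpr ⟨massShellMap m (etaMink * Λᵀ * etaMink),
    massShellMap_massShellMap hm hΛ hortho (lorentz_left_inv hΛ),
    massShellMap_massShellMap hm (lorentz_inv hΛ) (by rwa [lorentz_inv_zero_zero])
      (lorentz_right_inv hΛ)⟩

/-- The Jacobian matrix of `massShellMap m Λ` at `p`. -/
noncomputable def massShellJacobian (m : ℝ) (Λ : Matrix (Fin 4) (Fin 4) ℝ) (p : Fin 3 → ℝ) :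
    Matrix (Fin 3) (Fin 3) ℝ :=
  of fun i j => Λ i.succ j.succ + Λ i.succ 0 * (p j / energy m p)

theorem hasFDerivAt_energy {m : ℝ} (hm : 0 < m) (p : Fin 3 → ℝ) :
    HasFDerivAt (energy m)
      (∑ i, (p i / energy m p) • ContinuousLinearMap.proj (R := ℝ) (φ := fun _ : Fin 3 => ℝ) i)
      p := by
  have h : HasFDerivAt (fun p : Fin 3 → ℝ => m ^ 2 + ∑ i, p i ^ 2)
      (∑ i, (2 * p i) • ContinuousLinearMap.proj (R := ℝ) (φ := fun _ : Fin 3 => ℝ) i) p := by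
    refine (HasFDerivAt.fun_sum fun i _ => ?_).const_add _
    simpa using (hasFDerivAt_apply (𝕜 := ℝ) i p).pow 2
  have hpos : m ^ 2 + ∑ i, p i ^ 2 ≠ 0 := by positivity
  refine (h.sqrt hpos).congr_fderiv ?_
  rw [Finset.smul_sum]
  refine Finset.sum_congr rfl fun i _ => ?_
  rw [smul_smul]
  congr 1
  change 1 / (2 * energy m p) * _ = _
  have := (energy_pos hm p).ne'
  field_simp

theorem hasFDerivAt_massShellMap {m : ℝ} (hm : 0 < m) (Λ : Matrix (Fin 4) (Fin 4) ℝ)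
    (p : Fin 3 → ℝ) :
    HasFDerivAt (massShellMap m Λ)
      (LinearMap.toContinuousLinearMap (toLin' (massShellJacobian m Λ p))) p := by
  rw [hasFDerivAt_pi']
  intro i
  have h := ((hasFDerivAt_energy hm p).const_mul (Λ i.succ 0)).add
    (HasFDerivAt.fun_sum (u := Finset.univ) fun (j : Fin 3) _ =>
      (hasFDerivAt_apply (𝕜 := ℝ) j p).const_mul (Λ i.succ j.succ))
  refine h.congr_fderiv ?_
  ext v
  simp [massShellJacobian, mulVec, dotProduct, Fin.sum_univ_three]
  ring

theorem energy_mul_det_massShellJacobian {m : ℝ} (hm : 0 < m) {Λ : Matrix (Fin 4) (Fin 4) ℝ}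
    (hΛ : Λᵀ * etaMink * Λ = etaMink) (hortho : 0 < Λ 0 0) (p : Fin 3 → ℝ) :
    energy m p * (massShellJacobian m Λ p).det = energy m (massShellMap m Λ p) * Λ.det := by
  set q' := fourMomentum m (massShellMap m Λ p) with hq'
  have hrow : fourMomentum m p ᵥ* etaMink = ∑ k, (q' ᵥ* etaMink) k • Λ k := by
    rw [← vecMul_eq_sum, hq', ← mulVec_fourMomentum hm hΛ hortho, ← vecMul_transpose,
      vecMul_vecMul, vecMul_vecMul, ← mul_assoc, hΛ]
  have h1 : (Λ.updateRow 0 (fourMomentum m p ᵥ* etaMink)).det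
      = energy m (massShellMap m Λ p) * Λ.det := by
    rw [hrow, det_updateRow_sum]
    simp [hq', etaMink, vecMul_diagonal]
  rw [← h1]
  have := (energy_pos hm p).ne'
  rw [det_fin_three, det_succ_row_zero]
  simp [Fin.sum_univ_succ, det_fin_three, massShellJacobian, etaMink, vecMul_diagonal, submatrix,
    show Fin.succAbove (1 : Fin 4) (2 : Fin 3) = 3 from rfl,
    show Fin.succAbove (2 : Fin 4) (2 : Fin 3) = 3 from rfl,
    show Fin.succAbove (3 : Fin 4) (2 : Fin 3) = 2 from rfl]
  field_simp
  ring

/-- Lorentz invariance of the volume measure `d³p / p⁰` on the mass shell: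
if `Λ` is an orthochronous Lorentz matrix and `Φ(p)` is the spatial part of
`Λ (E(p), p)`, then the pushforward under `Φ` of Lebesgue measure with density
`1/E` is itself. -/
theorem mass_shell_measure_lorentz_invariant
    (m : ℝ) (hm : 0 < m)
    (Λ : Matrix (Fin 4) (Fin 4) ℝ)
    (hΛ : Λᵀ * etaMink * Λ = etaMink)
    (hortho : 0 < Λ 0 0) :
    Measure.map
      (fun p : Fin 3 → ℝ => fun i : Fin 3 =>
        Λ i.succ 0 * energy m p + ∑ j : Fin 3, Λ i.succ j.succ * p j)
      (volume.withDensity fun p => ENNReal.ofReal (1 / energy m p)) =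
      volume.withDensity fun p => ENNReal.ofReal (1 / energy m p) := by
  change Measure.map (massShellMap m Λ) _ = _
  have hbij := massShellMap_bijective hm hΛ hortho
  have hderiv := hasFDerivAt_massShellMap hm Λ
  have hmeas : Measurable (massShellMap m Λ) :=
    (continuous_iff_continuousAt.mpr fun p => (hderiv p).continuousAt).measurable
  ext s hs
  rw [Measure.map_apply hmeas hs, withDensity_apply _ (hmeas hs), withDensity_apply _ hs]
  conv_rhs => rw [← Set.image_preimage_eq s hbij.surjective]
  rw [lintegral_image_eq_lintegral_abs_det_fderiv_mul volume (hmeas hs)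
    (fun p _ => (hderiv p).hasFDerivWithinAt) hbij.injective.injOn]
  refine lintegral_congr fun p => ?_
  rw [← ENNReal.ofReal_mul (abs_nonneg _), LinearMap.det_toContinuousLinearMap, LinearMap.det_toLin']
  congr 1
  have hE := energy_pos hm p
  have hE' := energy_pos hm (massShellMap m Λ p)
  have h := congrArg abs (energy_mul_det_massShellJacobian hm hΛ hortho p)
  rw [abs_mul, abs_mul, abs_det_lorentz hΛ, abs_of_pos hE, abs_of_pos hE', mul_one] at h
  field_simp
  linarith
end
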